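/- Σ_{n=1}^∞ (−1)^n n^7 / sinh(nπ)^5 = −35Γ^8/(2^13 π^10) + 21Γ^16/(2^18 π^14) − 35Γ^16/(3·2^16 π^13) + 27Γ^16/(2^19 π^12) − 5Γ^24/(3·2^25 π^18), where Γ = Γ(1/4). -/

import Mathlib

open Real

section DivisorSeries

open UpperHalfPlane hiding I
open Complex Filter Topology ArithmeticFunction
open scoped Manifold ArithmeticFunction.sigma Derivative

/-- The series `∑ n ^ j σ_k(n) q ^ n` with `q = exp (2πiτ)`. -/
noncomputable def divisorSeries (j k : ℕ) (τ : ℍ) : ℂ :=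
  ∑' n : ℕ, (n : ℂ) ^ j * σ k n * cexp (2 * π * I * τ) ^ n

namespace divisorSeries

lemma norm_exp_eq (z : ℂ) : ‖cexp (2 * π * I * z)‖ = rexp (-2 * π * z.im) := by
  rw [Complex.norm_exp]; congr 1; simp

lemma norm_coeff_le (j k n : ℕ) : ‖(n : ℂ) ^ j * σ k n‖ ≤ (n : ℝ) ^ (j + k + 1) := by
  rw [norm_mul, norm_pow, Complex.norm_natCast, Complex.norm_natCast, add_assoc, pow_add]
  gcongr
  exact_mod_cast ArithmeticFunction.sigma_le_pow_succ k n

lemma summable_bound (m : ℕ) {r : ℝ} (hr0 : 0 ≤ r) (hr : r < 1) :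
    Summable fun n : ℕ ↦ (n : ℝ) ^ m * r ^ n :=
  summable_pow_mul_geometric_of_norm_lt_one m (by rwa [Real.norm_of_nonneg hr0])

lemma norm_term_le (j k n : ℕ) {r : ℝ} {q : ℂ} (hq : ‖q‖ ≤ r) :
    ‖(n : ℂ) ^ j * σ k n * q ^ n‖ ≤ (n : ℝ) ^ (j + k + 1) * r ^ n := by
  rw [norm_mul, norm_pow q]
  gcongr
  exact norm_coeff_le j k n

lemma summable_term (j k : ℕ) {q : ℂ} (hq : ‖q‖ < 1) :
    Summable fun n : ℕ ↦ (n : ℂ) ^ j * σ k n * q ^ n :=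
  .of_norm_bounded (summable_bound (j + k + 1) (norm_nonneg q) hq)
    fun n ↦ norm_term_le j k n le_rfl

lemma hasDerivAt (j k : ℕ) (τ : ℍ) :
    HasDerivAt (divisorSeries j k ∘ ofComplex) (2 * π * I * divisorSeries (j + 1) k τ) τ := by
  set r : ℝ := rexp (-2 * π * (τ.im / 2)) with hr
  have him := τ.im_pos
  have hr1 : r < 1 := by
    rw [hr, Real.exp_lt_one_iff]
    nlinarith [Real.pi_pos, mul_pos Real.pi_pos him]
  have hball : IsOpen {z : ℂ | τ.im / 2 < z.im} := isOpen_lt continuous_const continuous_im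
  have key := hasDerivAt_tsum_of_isPreconnected
    (g := fun (n : ℕ) (z : ℂ) ↦ (n : ℂ) ^ j * σ k n * cexp (2 * π * I * z) ^ n)
    (g' := fun (n : ℕ) (z : ℂ) ↦
      2 * π * I * ((n : ℂ) ^ (j + 1) * σ k n * cexp (2 * π * I * z) ^ n))
    (u := fun n : ℕ ↦ 2 * π * ((n : ℝ) ^ (j + 1 + k + 1) * r ^ n))
    (t := {z : ℂ | τ.im / 2 < z.im}) (y₀ := τ) (y := τ)
    ((summable_bound _ (Real.exp_pos _).le hr1).mul_left _) hball
    (convex_halfSpace_im_gt _).isPreconnected ?_ ?_ (by simp [him]) ?_ (by simp [him])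
  · have htsum : ∑' n : ℕ, 2 * π * I * ((n : ℂ) ^ (j + 1) * σ k n * cexp (2 * π * I * τ) ^ n) =
        2 * π * I * divisorSeries (j + 1) k τ := tsum_mul_left
    rw [htsum] at key
    refine key.congr_of_eventuallyEq ?_
    filter_upwards [isOpen_upperHalfPlaneSet.mem_nhds τ.im_pos] with z hz
    simp [divisorSeries, ofComplex_apply_of_im_pos hz]
  · intro n z _
    have h1 : HasDerivAt (fun z : ℂ ↦ cexp (2 * π * I * z))
        (cexp (2 * π * I * z) * (2 * π * I)) z := by
      simpa using ((hasDerivAt_id z).const_mul (2 * π * I)).cexp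
    refine ((h1.fun_pow n).const_mul ((n : ℂ) ^ j * σ k n)).congr_deriv ?_
    rcases n with _ | n
    · simp
    · simp only [Nat.add_sub_cancel]; push_cast; ring
  · intro n z hz
    have hz' : ‖cexp (2 * π * I * z)‖ ≤ r := by
      rw [norm_exp_eq, hr, Real.exp_le_exp]
      have : τ.im / 2 < z.im := hz
      nlinarith [Real.pi_pos]
    rw [norm_mul]
    have h2 : ‖(2 * π * I : ℂ)‖ = 2 * π := by simp [abs_of_pos Real.pi_pos]
    rw [h2]
    gcongr
    exact norm_term_le (j + 1) k n hz'
  · exact summable_term j k (norm_exp_two_pi_I_lt_one τ)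

lemma mdifferentiable (j k : ℕ) : MDiff (divisorSeries j k) := fun τ ↦
  UpperHalfPlane.mdifferentiableAt_iff.mpr (hasDerivAt j k τ).differentiableAt

lemma normalizedDeriv (j k : ℕ) : D (divisorSeries j k) = divisorSeries (j + 1) k := by
  ext τ
  rw [Derivative.normalizedDerivOfComplex, (hasDerivAt j k τ).deriv,
    inv_mul_cancel_left₀ two_pi_I_ne_zero]

lemma tendsto_zero (j k : ℕ) : Tendsto (divisorSeries j k) atImInfty (𝓝 0) := by
  have h0 : (∑' _ : ℕ, (0 : ℂ)) = 0 := tsum_zero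
  rw [← h0]
  set r : ℝ := rexp (-2 * π) with hr
  have hr1 : r < 1 := by
    rw [hr, Real.exp_lt_one_iff]
    nlinarith [Real.pi_pos]
  refine tendsto_tsum_of_dominated_convergence (summable_bound (j + k + 1) (Real.exp_pos _).le hr1)
    (fun n ↦ ?_) ?_
  · rcases n with _ | n
    · simp
    · have hq : Tendsto (fun τ : ℍ ↦ cexp (2 * π * I * τ)) atImInfty (𝓝 0) := by
        simpa [Function.Periodic.qParam] using qParam_tendsto_atImInfty one_pos
      simpa using (hq.pow (n + 1)).const_mul (((n + 1 : ℕ) : ℂ) ^ j * σ k (n + 1))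
  · have : ∀ᶠ τ : ℍ in atImInfty, 1 ≤ τ.im :=
      (tendsto_comap (f := UpperHalfPlane.im)).eventually_ge_atTop 1
    filter_upwards [this] with τ hτ n
    refine norm_term_le j k n ?_
    rw [norm_exp_eq, Real.exp_le_exp]
    have : (1 : ℝ) ≤ (τ : ℂ).im := hτ
    nlinarith [Real.pi_pos]

lemma eq_tsum_pnat (k : ℕ) (τ : ℍ) :
    divisorSeries 0 k τ = ∑' n : ℕ+, σ k n * cexp (2 * π * I * τ) ^ (n : ℕ) := by
  rw [tsum_pnat_eq_tsum_succ (f := fun n : ℕ ↦ (σ k n : ℂ) * cexp (2 * π * I * τ) ^ n),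
    divisorSeries,
    (summable_term 0 k (norm_exp_two_pi_I_lt_one τ)).tsum_eq_zero_add]
  simp

end divisorSeries

open ModularForm EisensteinSeries

lemma E₂_eq_divisorSeries : E2 = 1 - (24 : ℂ) • divisorSeries 0 1 := by
  ext τ
  simp [E2_eq_tsum_cexp, divisorSeries.eq_tsum_pnat]

lemma E_eq_divisorSeries {k : ℕ} (hk : 3 ≤ k) (hk2 : Even k) :
    ⇑(E hk) = 1 - (2 * k / bernoulli k : ℂ) • divisorSeries 0 (k - 1) := by
  ext τ
  rw [q_expansion_bernoulli hk hk2]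
  simp [divisorSeries.eq_tsum_pnat]

lemma E₄_eq_divisorSeries : ⇑E₄ = 1 + (240 : ℂ) • divisorSeries 0 3 := by
  rw [E₄, E_eq_divisorSeries _ (by decide), show bernoulli 4 = -1/30 by decide +kernel,
    sub_eq_add_neg, ← _root_.neg_smul]
  norm_num

lemma E₆_eq_divisorSeries : ⇑E₆ = 1 - (504 : ℂ) • divisorSeries 0 5 := by
  rw [E₆, E_eq_divisorSeries _ (by decide), show bernoulli 6 = 1/42 by decide +kernel]
  norm_num

lemma E₈_eq_divisorSeries :
    ⇑(E (by norm_num : 3 ≤ 8)) = 1 + (480 : ℂ) • divisorSeries 0 7 := by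
  rw [E_eq_divisorSeries _ (by decide), show bernoulli 8 = -1/30 by decide +kernel,
    sub_eq_add_neg, ← _root_.neg_smul]
  norm_num

lemma tendsto_E {k : ℕ} (hk : 3 ≤ k) (hk2 : Even k) : Tendsto (E hk) atImInfty (𝓝 1) := by
  rw [E_eq_divisorSeries hk hk2]
  simpa using! tendsto_const_nhds.sub
    ((divisorSeries.tendsto_zero 0 (k - 1)).const_smul (2 * k / bernoulli k : ℂ))

lemma tendsto_E2 : Tendsto E2 atImInfty (𝓝 1) := by
  rw [E₂_eq_divisorSeries]
  simpa using! tendsto_const_nhds.sub ((divisorSeries.tendsto_zero 0 1).const_smul (24 : ℂ))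

open scoped MatrixGroups ModularForm

/-- In weights `4, 6, 8, 10`, a level one modular form is determined by its value at infinity. -/
lemma eq_smul_E_of_tendsto {k : ℕ} (hk : 3 ≤ k) (hk2 : Even k) (hk12 : k < 12) {f : ℍ → ℂ}
    (hf : MDiff f) (hinv : ∀ γ : SL(2, ℤ), f ∣[(k : ℤ)] γ = f) {c : ℂ}
    (hlim : Tendsto f atImInfty (𝓝 c)) : f = c • ⇑(E hk) := by
  let F : ModularForm 𝒮ℒ k :=
    { toFun := f
      slash_action_eq' := fun _ ⟨γ, hγ⟩ ↦ hγ ▸ hinv γ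
      holo' := hf
      bdd_at_cusps' := fun {c} hc ↦ by
        rw [Subgroup.IsArithmetic.isCusp_iff_isCusp_SL2Z] at hc
        rw [OnePoint.isBoundedAt_iff_forall_SL2Z hc]
        intro γ _
        rw [hinv γ]
        exact hlim.isBigO_one ℝ }
  have hrank : Module.rank ℂ (ModularForm 𝒮ℒ k) = 1 := by
    rw [dimension_level_one k hk2, if_neg (by rw [Nat.ModEq]; grind)]
    simp [Nat.div_eq_of_lt hk12]
  obtain ⟨a, ha⟩ : ∃ a : ℂ, a • E hk = F :=
    (finrank_eq_one_iff_of_nonzero' (E hk) (E_ne_zero hk hk2)).mp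
      (Module.rank_eq_one_iff_finrank_eq_one.mp hrank) F
  have hfa : a • ⇑(E hk) = f := congrArg DFunLike.coe ha
  have h1 : Tendsto f atImInfty (𝓝 (a • 1)) := hfa ▸ (tendsto_E hk hk2).const_smul a
  rw [← hfa, tendsto_nhds_unique hlim h1]
  simp

lemma E_slash {k : ℕ} (hk : 3 ≤ k) (γ : SL(2, ℤ)) : ⇑(E hk) ∣[(k : ℤ)] γ = ⇑(E hk) :=
  SlashInvariantForm.slash_action_eqn (E hk) _ ⟨γ, rfl⟩

open Derivative

lemma normalizedDeriv_one_add_smul_divisorSeries (c : ℂ) (j k : ℕ) :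
    D (1 + c • divisorSeries j k) = c • divisorSeries (j + 1) k := by
  have hone : D (1 : ℍ → ℂ) = 0 := normalizedDerivOfComplex_const 1
  have hmd : MDiff (1 : ℍ → ℂ) := mdifferentiable_const
  have hdiff := divisorSeries.mdifferentiable j k
  rw [normalizedDerivOfComplex_add _ _ hmd (hdiff.const_smul _),
    normalizedDerivOfComplex_smul _ _ hdiff, divisorSeries.normalizedDeriv, hone, zero_add]

lemma normalizedDeriv_E₂ : D E2 = (-24 : ℂ) • divisorSeries 1 1 := by
  rw [E₂_eq_divisorSeries, sub_eq_add_neg, ← _root_.neg_smul,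
    normalizedDeriv_one_add_smul_divisorSeries]

lemma normalizedDeriv_E₄ : D E₄ = (240 : ℂ) • divisorSeries 1 3 := by
  rw [E₄_eq_divisorSeries, normalizedDeriv_one_add_smul_divisorSeries]

lemma normalizedDeriv_E₆ : D E₆ = (-504 : ℂ) • divisorSeries 1 5 := by
  rw [E₆_eq_divisorSeries, sub_eq_add_neg, ← _root_.neg_smul,
    normalizedDeriv_one_add_smul_divisorSeries]

lemma mdifferentiable_E₄ : MDiff (⇑E₄ : ℍ → ℂ) := E₄.holo'

lemma mdifferentiable_E₆ : MDiff (⇑E₆ : ℍ → ℂ) := E₆.holo'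

/-- Ramanujan's identity for the derivative of `E₄`. -/
lemma ramanujan_E₄ : D E₄ = (3⁻¹ : ℂ) • (E2 * E₄ - ⇑E₆) := by
  have hlim : Tendsto (serreDerivative 4 E₄) atImInfty (𝓝 (-3⁻¹)) := by
    have h1 := ((divisorSeries.tendsto_zero 1 3).const_smul (240 : ℂ)).sub
      ((tendsto_E2.mul (tendsto_E (by norm_num : 3 ≤ 4) (by decide))).const_mul (4 * 12⁻¹))
    convert! h1 using 2
    · simp [normalizedDeriv_E₄, mul_assoc]
    · norm_num
  have h := eq_smul_E_of_tendsto (by norm_num : 3 ≤ 6) (by decide) (by norm_num)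
    (serreDerivative_mdifferentiable 4 mdifferentiable_E₄)
    (fun γ ↦ by
      simpa using! serreDerivative_slash_invariant (k := 4) mdifferentiable_E₄ (E_slash _ γ)) hlim
  ext τ
  have hτ := congrFun h τ
  simp only [serreDerivative_apply, Pi.smul_apply, smul_eq_mul] at hτ
  simp only [Pi.smul_apply, Pi.sub_apply, Pi.mul_apply, smul_eq_mul]
  linear_combination hτ

/-- `E₄ ^ 2` is the Eisenstein series of weight `8`. -/
lemma E₄_sq : (⇑E₄ : ℍ → ℂ) * ⇑E₄ = ⇑(E (by norm_num : 3 ≤ 8)) := by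
  have hE := tendsto_E (by norm_num : 3 ≤ 4) (by decide)
  have h := eq_smul_E_of_tendsto (by norm_num : 3 ≤ 8) (by decide) (by norm_num)
    (mdifferentiable_E₄.mul mdifferentiable_E₄)
    (fun γ ↦ by
      have hE₄ : ⇑E₄ ∣[(4 : ℤ)] γ = ⇑E₄ := E_slash _ γ
      have hmul := ModularForm.mul_slash_SL2 4 4 γ E₄ E₄
      rwa [hE₄] at hmul) (hE.mul hE)
  simpa using! h

/-- Ramanujan's identity for the derivative of `E₆`. -/
lemma ramanujan_E₆ : D E₆ = (2⁻¹ : ℂ) • (E2 * E₆ - ⇑E₄ * ⇑E₄) := by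
  have hlim : Tendsto (serreDerivative 6 E₆) atImInfty (𝓝 (-2⁻¹)) := by
    have h1 := ((divisorSeries.tendsto_zero 1 5).const_smul (-504 : ℂ)).sub
      ((tendsto_E2.mul (tendsto_E (by norm_num : 3 ≤ 6) (by decide))).const_mul (6 * 12⁻¹))
    convert! h1 using 2
    · simp [normalizedDeriv_E₆, mul_assoc]
    · norm_num
  have h := eq_smul_E_of_tendsto (by norm_num : 3 ≤ 8) (by decide) (by norm_num)
    (serreDerivative_mdifferentiable 6 mdifferentiable_E₆)
    (fun γ ↦ by
      simpa using! serreDerivative_slash_invariant (k := 6) mdifferentiable_E₆ (E_slash _ γ)) hlim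
  ext τ
  have hτ := congrFun h τ
  rw [← E₄_sq] at hτ
  simp only [serreDerivative_apply, Pi.smul_apply, Pi.mul_apply, smul_eq_mul] at hτ
  simp only [Pi.smul_apply, Pi.sub_apply, Pi.mul_apply, smul_eq_mul]
  linear_combination hτ

lemma hasDerivAt_D2 (γ : SL(2, ℤ)) (τ : ℍ) :
    HasDerivAt (D2 γ ∘ ofComplex) (2 * π * I * ((4 * π ^ 2 : ℂ)⁻¹ * (D2 γ τ * D2 γ τ))) τ := by
  have hden := denom_ne_zero (γ : GL (Fin 2) ℝ) τ
  have h := (hasDerivAt_denom_zpow (γ : GL (Fin 2) ℝ) (-1) τ).const_mul (2 * π * I * γ 1 0)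
  refine (h.congr_of_eventuallyEq ?_).congr_deriv ?_
  · filter_upwards [isOpen_upperHalfPlaneSet.mem_nhds τ.im_pos] with z hz
    simp [D2, div_eq_mul_inv, ofComplex_apply_of_im_pos hz]
  · simp only [D2]
    have hpi : (π : ℂ) ≠ 0 := ofReal_ne_zero.mpr pi_ne_zero
    rw [show (-1 - 1 : ℤ) = -2 by norm_num, zpow_neg]
    norm_cast
    push_cast
    field_simp
    simp
    ring

lemma mdifferentiable_D2 (γ : SL(2, ℤ)) : MDiff (D2 γ) := fun τ ↦
  UpperHalfPlane.mdifferentiableAt_iff.mpr (hasDerivAt_D2 γ τ).differentiableAt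

lemma normalizedDeriv_D2 (γ : SL(2, ℤ)) : D (D2 γ) = ((4 * π ^ 2 : ℂ)⁻¹) • (D2 γ * D2 γ) := by
  ext τ
  rw [normalizedDerivOfComplex, (hasDerivAt_D2 γ τ).deriv, inv_mul_cancel_left₀ two_pi_I_ne_zero]
  simp

lemma serreDeriv_E₂_slash (γ : SL(2, ℤ)) :
    serreDerivative 1 E2 ∣[(4 : ℤ)] γ = serreDerivative 1 E2 := by
  have hD := normalizedDerivOfComplex_SL_slash (k := 2) E2_mdifferentiable (γ := γ)
  rw [E2_slash_action, normalizedDerivOfComplex_sub _ _ E2_mdifferentiable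
    ((mdifferentiable_D2 γ).const_smul _), normalizedDerivOfComplex_smul _ _ (mdifferentiable_D2 γ),
    normalizedDeriv_D2] at hD
  have hE := ModularForm.mul_slash_SL2 2 2 γ E2 E2
  rw [E2_slash_action] at hE
  have hser : serreDerivative 1 E2 = D E2 - (12⁻¹ : ℂ) • (E2 * E2) := by
    ext τ
    simp [mul_assoc]
  have hsm := ModularForm.SL_smul_slash 4 γ (E2 * E2) (12⁻¹ : ℂ)
  rw [hser, sub_eq_add_neg, SlashAction.add_slash, SlashAction.neg_slash, hsm]
  ext τ
  have hDτ := congrFun hD τ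
  have hEτ := congrFun hE τ
  have hpi : (π : ℂ) ≠ 0 := ofReal_ne_zero.mpr pi_ne_zero
  have hden : (γ 1 0 : ℂ) / denom γ τ = (2 * π * I)⁻¹ * D2 γ τ := by
    rw [D2, mul_div_assoc, inv_mul_cancel_left₀ two_pi_I_ne_zero]
  simp only [Pi.sub_apply, Pi.smul_apply, Pi.mul_apply, smul_eq_mul, riemannZeta_two, hden]
    at hDτ hEτ
  simp only [Pi.add_apply, Pi.neg_apply, Pi.smul_apply, smul_eq_mul, Pi.mul_apply]
  rw [show (2 + 2 : ℤ) = 4 by norm_num] at hDτ hEτ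
  rw [hEτ, ← sub_eq_zero]
  have hI : I⁻¹ = -I := inv_I
  rw [eq_sub_iff_add_eq] at hDτ
  rw [← hDτ]
  simp only [mul_inv, hI]
  push_cast
  field_simp
  ring_nf
  simp only [I_sq]
  ring

/-- Ramanujan's identity for the derivative of `E₂`. -/
lemma ramanujan_E₂ : D E2 = (12⁻¹ : ℂ) • (E2 * E2 - ⇑E₄) := by
  have hlim : Tendsto (serreDerivative 1 E2) atImInfty (𝓝 (-12⁻¹)) := by
    have h1 := ((divisorSeries.tendsto_zero 1 1).const_smul (-24 : ℂ)).sub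
      ((tendsto_E2.mul tendsto_E2).const_mul (1 * 12⁻¹))
    convert! h1 using 2
    · simp [normalizedDeriv_E₂, mul_assoc]
    · norm_num
  have h := eq_smul_E_of_tendsto (by norm_num : 3 ≤ 4) (by decide) (by norm_num)
    (serreDerivative_mdifferentiable 1 E2_mdifferentiable) serreDeriv_E₂_slash hlim
  ext τ
  have hτ := congrFun h τ
  simp only [serreDerivative_apply, Pi.smul_apply, smul_eq_mul] at hτ
  simp only [Pi.smul_apply, Pi.sub_apply, Pi.mul_apply, smul_eq_mul]
  linear_combination hτ

end DivisorSeries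

section DerivativeValues

open UpperHalfPlane hiding I
open Complex Filter Topology ModularForm EisensteinSeries
open scoped Manifold MatrixGroups Derivative

lemma hasDerivAt_comp_ofComplex {F : ℍ → ℂ} (hF : MDiff F) (τ : ℍ) :
    HasDerivAt (F ∘ ofComplex) (2 * π * I * D F τ) τ := by
  rw [Derivative.normalizedDerivOfComplex, mul_inv_cancel_left₀ two_pi_I_ne_zero]
  exact (UpperHalfPlane.mdifferentiableAt_iff.mp (hF τ)).hasDerivAt

lemma hasDerivAt_E₂ (τ : ℍ) : HasDerivAt (E2 ∘ ofComplex)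
    (2 * π * I * ((E2 τ ^ 2 - E₄ τ) / 12)) τ := by
  refine (hasDerivAt_comp_ofComplex E2_mdifferentiable τ).congr_deriv ?_
  rw [ramanujan_E₂]
  simp
  ring

lemma hasDerivAt_E₄ (τ : ℍ) : HasDerivAt (E₄ ∘ ofComplex)
    (2 * π * I * ((E2 τ * E₄ τ - E₆ τ) / 3)) τ := by
  refine (hasDerivAt_comp_ofComplex mdifferentiable_E₄ τ).congr_deriv ?_
  rw [ramanujan_E₄]
  simp
  ring

lemma hasDerivAt_E₆ (τ : ℍ) : HasDerivAt (E₆ ∘ ofComplex)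
    (2 * π * I * ((E2 τ * E₆ τ - E₄ τ ^ 2) / 2)) τ := by
  refine (hasDerivAt_comp_ofComplex mdifferentiable_E₆ τ).congr_deriv ?_
  rw [ramanujan_E₆]
  simp
  ring

/-- Computes `divisorSeries (j + 1) k` from a closed form for `divisorSeries j k`. -/
lemma divisorSeries_succ_eq {j k : ℕ} {F : ℍ → ℂ} (hF : divisorSeries j k = F) {τ : ℍ} {d : ℂ}
    (hd : HasDerivAt (F ∘ ofComplex) (2 * π * I * d) τ) : divisorSeries (j + 1) k τ = d := by
  have h := (divisorSeries.hasDerivAt j k τ).unique (hF ▸ hd)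
  exact mul_left_cancel₀ two_pi_I_ne_zero h

lemma divisorSeries_zero_seven (τ : ℍ) : divisorSeries 0 7 τ = (E₄ τ ^ 2 - 1) / 480 := by
  have h := congrFun (E₄_sq.trans E₈_eq_divisorSeries) τ
  simp only [Pi.mul_apply, Pi.add_apply, Pi.one_apply, Pi.smul_apply, smul_eq_mul] at h
  rw [pow_two, h]
  ring

lemma divisorSeries_one_five :
    divisorSeries 1 5 = fun τ ↦ (E₄ τ ^ 2 - E2 τ * E₆ τ) / 1008 := by
  have h := normalizedDeriv_E₆.symm.trans ramanujan_E₆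
  ext τ
  have hτ := congrFun h τ
  simp only [Pi.mul_apply, Pi.sub_apply, Pi.smul_apply, smul_eq_mul] at hτ
  linear_combination (-1 / 504) * hτ

lemma divisorSeries_two_five {τ : ℍ} (hτ : E₆ τ = 0) :
    divisorSeries 2 5 τ = E2 τ * E₄ τ ^ 2 / 864 := by
  refine divisorSeries_succ_eq divisorSeries_one_five ?_
  refine ((((hasDerivAt_E₄ τ).fun_pow 2).fun_sub
    ((hasDerivAt_E₂ τ).fun_mul (hasDerivAt_E₆ τ))).div_const 1008).congr_deriv ?_
  simp [hτ]
  ring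

lemma divisorSeries_one_three :
    divisorSeries 1 3 = fun τ ↦ (E2 τ * E₄ τ - E₆ τ) / 720 := by
  have h := normalizedDeriv_E₄.symm.trans ramanujan_E₄
  ext τ
  have hτ := congrFun h τ
  simp only [Pi.mul_apply, Pi.sub_apply, Pi.smul_apply, smul_eq_mul] at hτ
  linear_combination (1 / 240) * hτ

lemma divisorSeries_two_three : divisorSeries 2 3 =
    fun τ ↦ (E2 τ ^ 2 * E₄ τ + E₄ τ ^ 2 - 2 * (E2 τ * E₆ τ)) / 1728 := by
  ext τ
  refine divisorSeries_succ_eq divisorSeries_one_three ?_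
  refine ((((hasDerivAt_E₂ τ).fun_mul (hasDerivAt_E₄ τ)).fun_sub
    (hasDerivAt_E₆ τ)).div_const 720).congr_deriv ?_
  simp
  ring

lemma divisorSeries_three_three : divisorSeries 3 3 =
    fun τ ↦ (E2 τ ^ 3 * E₄ τ + 3 * (E2 τ * E₄ τ ^ 2) - 3 * (E2 τ ^ 2 * E₆ τ) -
      E₄ τ * E₆ τ) / 3456 := by
  ext τ
  refine divisorSeries_succ_eq divisorSeries_two_three ?_
  have hP := hasDerivAt_E₂ τ
  have hQ := hasDerivAt_E₄ τ
  have hR := hasDerivAt_E₆ τ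
  refine (((((hP.fun_pow 2).fun_mul hQ).fun_add (hQ.fun_pow 2)).fun_sub
    ((hP.fun_mul hR).const_mul 2)).div_const 1728).congr_deriv ?_
  simp
  ring

lemma divisorSeries_four_three {τ : ℍ} (hτ : E₆ τ = 0) : divisorSeries 4 3 τ =
    (7 * (E2 τ ^ 4 * E₄ τ) + 42 * (E2 τ ^ 2 * E₄ τ ^ 2) + 3 * E₄ τ ^ 3) / 41472 := by
  refine divisorSeries_succ_eq divisorSeries_three_three ?_
  have hP := hasDerivAt_E₂ τ
  have hQ := hasDerivAt_E₄ τ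
  have hR := hasDerivAt_E₆ τ
  refine ((((((hP.fun_pow 3).fun_mul hQ).fun_add ((hP.fun_mul (hQ.fun_pow 2)).const_mul 3)).fun_sub
    (((hP.fun_pow 2).fun_mul hR).const_mul 3)).fun_sub (hQ.fun_mul hR)).div_const 3456).congr_deriv
    ?_
  simp [hτ]
  ring

end DerivativeValues

section GaussianPoints

open UpperHalfPlane hiding I
open Complex Filter Topology ModularForm EisensteinSeries
open scoped MatrixGroups

lemma E₂_smul (γ : SL(2, ℤ)) (τ : ℍ) :
    E2 (γ • τ) = denom γ τ ^ 2 * E2 τ - 6 * I / π * γ 1 0 * denom γ τ := by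
  have h := congrFun (E2_slash_action γ) τ
  have hden := denom_ne_zero (γ : GL (Fin 2) ℝ) τ
  have hpi : (π : ℂ) ≠ 0 := ofReal_ne_zero.mpr pi_ne_zero
  simp only [ModularForm.SL_slash_apply, Pi.sub_apply, Pi.smul_apply, smul_eq_mul, D2,
    riemannZeta_two, zpow_neg] at h
  norm_cast at h
  rw [← div_eq_mul_inv, div_eq_iff (pow_ne_zero 2 hden)] at h
  rw [h]
  push_cast
  field_simp

lemma E_smul {k : ℕ} (hk : 3 ≤ k) (γ : SL(2, ℤ)) (τ : ℍ) :
    E hk (γ • τ) = denom γ τ ^ k * E hk τ := by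
  have h := congrFun (E_slash hk γ) τ
  have hden := denom_ne_zero (γ : GL (Fin 2) ℝ) τ
  simp only [ModularForm.SL_slash_apply, zpow_neg] at h
  rw [← h]
  norm_cast
  field_simp

lemma S_smul_I : ModularGroup.S • UpperHalfPlane.I = UpperHalfPlane.I := by
  rw [UpperHalfPlane.modular_S_smul]
  ext
  simp

lemma E₂_I : E2 UpperHalfPlane.I = 3 / π := by
  have h := E₂_smul ModularGroup.S UpperHalfPlane.I
  have hpi : (π : ℂ) ≠ 0 := ofReal_ne_zero.mpr pi_ne_zero
  rw [S_smul_I, ModularGroup.denom_S, UpperHalfPlane.coe_I, I_sq,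
    show ModularGroup.S 1 0 = 1 from rfl] at h
  field_simp at h ⊢
  push_cast at h
  linear_combination h / 2 - 3 * I_sq

lemma E₆_I : E₆ UpperHalfPlane.I = 0 := by
  have h := E_smul (by norm_num : 3 ≤ 6) ModularGroup.S UpperHalfPlane.I
  rw [S_smul_I, ModularGroup.denom_S, UpperHalfPlane.coe_I,
    show I ^ 6 = -1 by rw [show 6 = 2 * 3 by norm_num, pow_mul, I_sq]; norm_num] at h
  linear_combination h / 2

section AtOneAddI

variable {τ : ℍ}

lemma eq_T_smul_I (hτ : (τ : ℂ) = 1 + I) : τ = ModularGroup.T • UpperHalfPlane.I := by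
  ext
  rw [hτ, coe_specialLinearGroup_apply]
  simp [ModularGroup.T, add_comm]

lemma denom_T (z : ℍ) : denom (ModularGroup.T : GL (Fin 2) ℝ) z = 1 := by
  rw [ModularGroup.denom_apply, show ModularGroup.T 1 0 = 0 from rfl,
    show ModularGroup.T 1 1 = 1 from rfl]
  simp

lemma E₂_one_add_I (hτ : (τ : ℂ) = 1 + I) : E2 τ = 3 / π := by
  rw [eq_T_smul_I hτ, E₂_smul, denom_T, show ModularGroup.T 1 0 = 0 from rfl, E₂_I]
  simp

lemma E₄_one_add_I (hτ : (τ : ℂ) = 1 + I) : E₄ τ = E₄ UpperHalfPlane.I := by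
  rw [eq_T_smul_I hτ, E_smul, denom_T, one_pow, one_mul]

lemma E₆_one_add_I (hτ : (τ : ℂ) = 1 + I) : E₆ τ = 0 := by
  rw [eq_T_smul_I hτ, E_smul, E₆_I, mul_zero]

end AtOneAddI

section AtHalfOneAddI

variable {τ : ℍ}

lemma S_mul_T_inv_coe :
    ((ModularGroup.S * ModularGroup.T⁻¹ : SL(2, ℤ)) : Matrix (Fin 2) (Fin 2) ℤ) =
      !![0, -1; 1, -1] := by
  decide

lemma eq_S_mul_T_inv_smul_I (hτ : (τ : ℂ) = (1 + I) / 2) :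
    τ = (ModularGroup.S * ModularGroup.T⁻¹) • UpperHalfPlane.I := by
  ext
  have h : (I - 1 : ℂ) ≠ 0 := fun h ↦ by simpa using congrArg Complex.im h
  rw [hτ, coe_specialLinearGroup_apply, S_mul_T_inv_coe]
  simp [← sub_eq_add_neg]
  field_simp
  ring_nf
  rw [I_sq]
  norm_num

lemma denom_S_mul_T_inv :
    denom ((ModularGroup.S * ModularGroup.T⁻¹ : SL(2, ℤ)) : GL (Fin 2) ℝ) UpperHalfPlane.I =
      I - 1 := by
  rw [ModularGroup.denom_apply, S_mul_T_inv_coe]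
  simp [sub_eq_add_neg]

lemma E₂_half_one_add_I (hτ : (τ : ℂ) = (1 + I) / 2) : E2 τ = 6 / π := by
  rw [eq_S_mul_T_inv_smul_I hτ, E₂_smul, denom_S_mul_T_inv, E₂_I, S_mul_T_inv_coe]
  have hpi : (π : ℂ) ≠ 0 := ofReal_ne_zero.mpr pi_ne_zero
  simp
  field_simp
  ring_nf
  rw [I_sq]
  norm_num

lemma E₄_half_one_add_I (hτ : (τ : ℂ) = (1 + I) / 2) : E₄ τ = -4 * E₄ UpperHalfPlane.I := by
  rw [eq_S_mul_T_inv_smul_I hτ, E_smul, denom_S_mul_T_inv]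
  have hpow : (I - 1) ^ 4 = -4 := by
    linear_combination (I ^ 2 - 4 * I + 5) * I_sq
  rw [hpow]

lemma E₆_half_one_add_I (hτ : (τ : ℂ) = (1 + I) / 2) : E₆ τ = 0 := by
  rw [eq_S_mul_T_inv_smul_I hτ, E_smul, E₆_I, mul_zero]

end AtHalfOneAddI

end GaussianPoints

open Set Filter Topology MeasureTheory in
/-- A positive solution of `f'² = 4f³ - 4a²f` with a pole at `0` and a critical point at `1/2`
has its half period given by a Beta integral. -/
theorem betaIntegral_eq_of_half_period {f : ℝ → ℝ} {a : ℝ} (ha : 0 < a)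
    (hf : AnalyticOnNhd ℝ f (Ioo 0 1))
    (hode : ∀ x ∈ Ioo (0 : ℝ) 1, deriv f x ^ 2 = 4 * f x ^ 3 - 4 * a ^ 2 * f x)
    (h0 : Tendsto f (𝓝[>] 0) atTop) (hzero : f 0 = 0) (hhalf : deriv f (1 / 2) = 0) :
    Complex.betaIntegral (1 / 4) (1 / 2) = 2 * (√a : ℝ) := by
  have hdiff : ∀ x ∈ Ioo (0 : ℝ) 1, HasDerivAt f (deriv f x) x := fun x hx =>
    (hf x hx).differentiableAt.hasDerivAt
  have hdf : AnalyticOnNhd ℝ (deriv f) (Ioo 0 1) := hf.deriv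
  have hcont : ContinuousOn f (Ioo 0 1) := hf.continuousOn
  have hsub : Ioc (0 : ℝ) (1 / 2) ⊆ Ioo 0 1 := fun x hx => ⟨hx.1, by linarith [hx.2]⟩
  have hlarge : ∀ x ∈ Ioo (0 : ℝ) 1, ∀ M, ∃ y ∈ Ioo (0 : ℝ) x, M < f y := by
    intro x hx M
    have h1 := h0.eventually (eventually_gt_atTop M)
    have h2 : ∀ᶠ y in 𝓝[>] (0 : ℝ), y ∈ Ioo 0 x := Ioo_mem_nhdsGT hx.1
    obtain ⟨y, hy1, hy2⟩ := (h1.and h2).exists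
    exact ⟨y, hy2, hy1⟩
  have hge : ∀ x ∈ Ioo (0 : ℝ) 1, a ≤ f x := by
    intro x hx
    by_contra! hlt
    obtain ⟨y, hy, hfy⟩ := hlarge x hx a
    obtain ⟨c, hc1, hc2⟩ := exists_between (max_lt hlt ha)
    have hc0 : 0 < c := (le_max_right _ _).trans_lt hc1
    have hcx : f x < c := (le_max_left _ _).trans_lt hc1
    have hsubI : Icc y x ⊆ Ioo 0 1 := fun t ht => ⟨hy.1.trans_le ht.1, ht.2.trans_lt hx.2⟩
    obtain ⟨t, ht, rfl⟩ := intermediate_value_Icc' hy.2.le (hcont.mono hsubI)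
      ⟨hcx.le, (hc2.trans hfy).le⟩
    have := hode t (hsubI ht)
    nlinarith [sq_nonneg (deriv f t), mul_pos hc0 (mul_pos (sub_pos.2 hc2) (add_pos hc0 ha))]
  have hpos : ∀ x ∈ Ioo (0 : ℝ) 1, 0 < f x := fun x hx => ha.trans_le (hge x hx)
  have hsecond : ∀ x ∈ Ioo (0 : ℝ) 1, deriv (deriv f) x = 6 * f x ^ 2 - 2 * a ^ 2 := by
    have hprod : ∀ x ∈ Ioo (0 : ℝ) 1,
        deriv f x * (deriv (deriv f) x - (6 * f x ^ 2 - 2 * a ^ 2)) = 0 := by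
      intro x hx
      have h1 : HasDerivAt (fun y => deriv f y ^ 2) (2 * deriv f x * deriv (deriv f) x) x := by
        simpa using (hdf x hx).differentiableAt.hasDerivAt.fun_pow 2
      have h2 : HasDerivAt (fun y => 4 * f y ^ 3 - 4 * a ^ 2 * f y)
          (4 * (3 * f x ^ 2 * deriv f x) - 4 * a ^ 2 * deriv f x) x := by
        simpa using (((hdiff x hx).fun_pow 3).const_mul 4).fun_sub
          ((hdiff x hx).const_mul (4 * a ^ 2))
      have h3 : (fun y => deriv f y ^ 2) =ᶠ[𝓝 x] fun y => 4 * f y ^ 3 - 4 * a ^ 2 * f y := by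
        filter_upwards [isOpen_Ioo.mem_nhds hx] with y hy using hode y hy
      have h4 := h1.unique (h2.congr_of_eventuallyEq h3)
      linarith
    rcases hdf.eq_zero_or_eq_zero_of_mul_eq_zero
      (g := fun x => deriv (deriv f) x - (6 * f x ^ 2 - 2 * a ^ 2))
      (hdf.deriv.sub ((analyticOnNhd_const.mul (hf.pow 2)).sub analyticOnNhd_const)) hprod
      isPreconnected_Ioo with h | h
    · obtain ⟨y, hy, hfy⟩ := hlarge (1 / 2) (by norm_num) (f (1 / 2))
      have hy' : y ∈ Ioo (0 : ℝ) 1 := ⟨hy.1, by linarith [hy.2]⟩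
      have := isOpen_Ioo.is_const_of_deriv_eq_zero (isPreconnected_Ioo)
        (fun x hx => (hdiff x hx).differentiableAt.differentiableWithinAt) h hy'
        (show (1 / 2 : ℝ) ∈ Ioo 0 1 by norm_num)
      linarith
    · intro x hx
      linarith [h x hx]
  have hmono : StrictMonoOn (deriv f) (Ioc 0 (1 / 2)) := by
    refine strictMonoOn_of_deriv_pos (convex_Ioc _ _) (hdf.continuousOn.mono hsub) fun x hx => ?_
    have hx' := hsub (interior_subset hx)
    rw [hsecond x hx']
    nlinarith [hge x hx']
  have hneg : ∀ x ∈ Ioo (0 : ℝ) (1 / 2), deriv f x < 0 := fun x hx => by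
    rw [← hhalf]
    exact hmono ⟨hx.1, hx.2.le⟩ ⟨by norm_num, le_rfl⟩ hx.2
  set u : ℝ → ℝ := fun x => a ^ 2 / f x ^ 2 with hu
  have hu0 : u 0 = 0 := by simp [hu, hzero]
  have hu1 : u (1 / 2) = 1 := by
    have h12 : (1 / 2 : ℝ) ∈ Ioo 0 1 := by norm_num
    have h := hode _ h12
    rw [hhalf] at h
    have h' : f (1 / 2) * (f (1 / 2) ^ 2 - a ^ 2) = 0 := by linarith
    rcases mul_eq_zero.1 h' with h | h
    · exact absurd h (hpos _ h12).ne'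
    · simp only [hu]
      rw [sub_eq_zero.1 h, div_self (by positivity)]
  have huderiv : ∀ x ∈ Ioo (0 : ℝ) (1 / 2),
      HasDerivAt u (2 * a ^ 2 * (-deriv f x) / f x ^ 3) x := by
    intro x hx
    have hx' := hsub ⟨hx.1, hx.2.le⟩
    have := hpos x hx'
    have h := ((hdiff x hx').pow 2).inv (pow_ne_zero 2 this.ne') |>.const_mul (a ^ 2)
    convert! h using 1
    simp
    field_simp
  have hucont : ContinuousOn u (Icc 0 (1 / 2)) := by
    intro x hx
    rcases hx.1.eq_or_lt with rfl | hx0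
    · have h1 : Tendsto u (𝓝[>] 0) (𝓝 0) := by
        have h2 := ((tendsto_pow_atTop two_ne_zero).comp h0).inv_tendsto_atTop.const_mul (a ^ 2)
        simpa [hu, div_eq_mul_inv, Function.comp_def] using h2
      have h2 : ContinuousWithinAt u (Ioi 0) 0 := by
        rw [ContinuousWithinAt, hu0]; exact h1
      exact (continuousWithinAt_Ioi_iff_Ici.1 h2).mono Icc_subset_Ici_self
    · have hx' := hsub ⟨hx0, hx.2⟩
      exact ((continuousAt_const (y := a ^ 2)).div ((hdiff x hx').continuousAt.pow 2)
        (pow_ne_zero 2 (hpos x hx').ne')).continuousWithinAt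
  have humono : StrictMonoOn u (Icc 0 (1 / 2)) := by
    refine strictMonoOn_of_deriv_pos (convex_Icc _ _) hucont fun x hx => ?_
    rw [interior_Icc] at hx
    rw [(huderiv x hx).deriv]
    have := hpos x (hsub ⟨hx.1, hx.2.le⟩)
    have := neg_pos.2 (hneg x hx)
    positivity
  have himage : u '' Ioo 0 (1 / 2) = Ioo 0 1 := by
    apply Subset.antisymm
    · rintro _ ⟨x, hx, rfl⟩
      rw [← hu0, ← hu1]
      exact ⟨humono ⟨le_rfl, by norm_num⟩ ⟨hx.1.le, hx.2.le⟩ hx.1,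
        humono ⟨hx.1.le, hx.2.le⟩ ⟨by norm_num, le_rfl⟩ hx.2⟩
    · have := intermediate_value_Ioo (by norm_num : (0 : ℝ) ≤ 1 / 2) hucont
      rwa [hu0, hu1] at this
  have hinteg : ∀ x ∈ Ioo (0 : ℝ) (1 / 2),
      |2 * a ^ 2 * (-deriv f x) / f x ^ 3| •
        (((u x : ℝ) : ℂ) ^ ((1 / 4 : ℂ) - 1) * (1 - ((u x : ℝ) : ℂ)) ^ ((1 / 2 : ℂ) - 1)) =
      ((4 * √a : ℝ) : ℂ) := by
    intro x hx
    have hx' := hsub ⟨hx.1, hx.2.le⟩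
    have hfx := hpos x hx'
    obtain ⟨s, hs, hs'⟩ : ∃ s, 0 < s ∧ -deriv f x = s := ⟨_, neg_pos.2 (hneg x hx), rfl⟩
    have hss : s ^ 2 = 4 * f x ^ 3 - 4 * a ^ 2 * f x := by rw [← hs', neg_sq, hode x hx']
    set α := √a with hα
    set φ := √(f x) with hφ
    have hα0 : 0 < α := Real.sqrt_pos.2 ha
    have hφ0 : 0 < φ := Real.sqrt_pos.2 hfx
    have haα : a = α ^ 2 := (Real.sq_sqrt ha.le).symm
    have hfφ : f x = φ ^ 2 := (Real.sq_sqrt hfx.le).symm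
    rw [hfφ, haα] at hss
    have hux : u x = (α / φ) ^ (4 : ℝ) := by
      rw [show (4 : ℝ) = ((4 : ℕ) : ℝ) by norm_num, Real.rpow_natCast]
      simp only [hu]
      rw [hfφ, haα]
      field_simp
    have hux1 : 1 - u x = (s / (2 * φ ^ 3)) ^ (2 : ℝ) := by
      rw [show (2 : ℝ) = ((2 : ℕ) : ℝ) by norm_num, Real.rpow_natCast]
      simp only [hu]
      rw [hfφ, haα]
      field_simp
      push_cast
      linear_combination -hss
    have h1 : ((u x : ℝ) : ℂ) ^ ((1 / 4 : ℂ) - 1) = ((((α / φ) ^ 3)⁻¹ : ℝ) : ℂ) := by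
      rw [show (1 / 4 : ℂ) - 1 = ((-(3 / 4) : ℝ) : ℂ) by push_cast; norm_num,
        ← Complex.ofReal_cpow (by rw [hux]; positivity), hux, ← Real.rpow_mul (by positivity),
        show (4 : ℝ) * -(3 / 4) = -((3 : ℕ) : ℝ) by norm_num, Real.rpow_neg (by positivity),
        Real.rpow_natCast]
    have h2 : (1 - ((u x : ℝ) : ℂ)) ^ ((1 / 2 : ℂ) - 1) = (((s / (2 * φ ^ 3))⁻¹ : ℝ) : ℂ) := by
      rw [show (1 / 2 : ℂ) - 1 = ((-(1 / 2) : ℝ) : ℂ) by push_cast; norm_num,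
        show (1 - ((u x : ℝ) : ℂ)) = ((1 - u x : ℝ) : ℂ) by push_cast; rfl,
        ← Complex.ofReal_cpow (by rw [hux1]; positivity), hux1, ← Real.rpow_mul (by positivity),
        show (2 : ℝ) * -(1 / 2) = -1 by norm_num, Real.rpow_neg_one]
    rw [h1, h2, hs', abs_of_pos (by positivity), Complex.real_smul, ← Complex.ofReal_mul,
      ← Complex.ofReal_mul]
    congr 1
    rw [hfφ, haα]
    field_simp
    ring
  rw [Complex.betaIntegral, intervalIntegral.integral_of_le zero_le_one,
    integral_Ioc_eq_integral_Ioo, ← himage, integral_image_eq_integral_abs_deriv_smul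
      measurableSet_Ioo (fun x hx => (huderiv x hx).hasDerivWithinAt)
      (humono.injOn.mono Ioo_subset_Icc_self), setIntegral_congr_fun measurableSet_Ioo hinteg]
  simp
  ring

/-- The period pair spanning the Gaussian integers. -/
noncomputable def gaussianPeriods : PeriodPair where
  ω₁ := 1
  ω₂ := Complex.I
  indep := by
    rw [LinearIndependent.pair_iff]
    intro s t h
    simpa [Complex.ext_iff] using h

namespace gaussianPeriods

open PeriodPair

lemma mem_lattice_iff {x : ℂ} :
    x ∈ gaussianPeriods.lattice ↔ ∃ m n : ℤ, (m + n * Complex.I : ℂ) = x := by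
  simp [PeriodPair.mem_lattice, gaussianPeriods]

lemma conj_mem_lattice {x : ℂ} (hx : x ∈ gaussianPeriods.lattice) :
    (starRingEnd ℂ) x ∈ gaussianPeriods.lattice := by
  obtain ⟨m, n, rfl⟩ := mem_lattice_iff.1 hx
  exact mem_lattice_iff.2 ⟨m, -n, by simp⟩

lemma I_mul_mem_lattice {x : ℂ} (hx : x ∈ gaussianPeriods.lattice) :
    Complex.I * x ∈ gaussianPeriods.lattice := by
  obtain ⟨m, n, rfl⟩ := mem_lattice_iff.1 hx
  exact mem_lattice_iff.2 ⟨-n, m, by push_cast; linear_combination -n * Complex.I_sq⟩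

/-- Complex conjugation on the Gaussian lattice. -/
noncomputable def conjEquiv : gaussianPeriods.lattice ≃ gaussianPeriods.lattice where
  toFun l := ⟨_, conj_mem_lattice l.2⟩
  invFun l := ⟨_, conj_mem_lattice l.2⟩
  left_inv l := by simp
  right_inv l := by simp

/-- Multiplication by `I` on the Gaussian lattice. -/
noncomputable def mulIEquiv : gaussianPeriods.lattice ≃ gaussianPeriods.lattice where
  toFun l := ⟨_, I_mul_mem_lattice l.2⟩
  invFun l := ⟨_, neg_mem (I_mul_mem_lattice l.2)⟩
  left_inv l := by ext; simp [← mul_assoc]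
  right_inv l := by ext; simp [← mul_assoc]

lemma weierstrassP_conj (z : ℂ) :
    weierstrassP gaussianPeriods ((starRingEnd ℂ) z) =
      (starRingEnd ℂ) (weierstrassP gaussianPeriods z) := by
  rw [weierstrassP, weierstrassP, Complex.conj_tsum, ← conjEquiv.tsum_eq]
  simp [conjEquiv]

lemma weierstrassP_ofReal (x : ℝ) :
    weierstrassP gaussianPeriods x = ((weierstrassP gaussianPeriods x).re : ℝ) := by
  rw [eq_comm, ← Complex.conj_eq_iff_re, ← weierstrassP_conj, Complex.conj_ofReal]

lemma G_six : gaussianPeriods.G 6 = 0 := by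
  have h : gaussianPeriods.G 6 = -gaussianPeriods.G 6 := by
    conv_lhs => rw [G, ← mulIEquiv.tsum_eq]
    rw [G, ← tsum_neg]
    congr 1 with l
    simp [mulIEquiv, mul_pow, show Complex.I ^ 6 = -1 by
      rw [show 6 = 4 + 2 by rfl, pow_add, Complex.I_pow_four]; simp]
  exact CharZero.eq_neg_self_iff.1 h

lemma G_four : gaussianPeriods.G 4 = π ^ 4 / 45 * ModularForm.E₄ UpperHalfPlane.I := by
  have h := tsum_eisSummand_eq_riemannZeta_mul_eisensteinSeries (k := 4) (by norm_num)
    UpperHalfPlane.I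
  have hE : ModularForm.E₄ UpperHalfPlane.I =
      (1 / 2 : ℂ) * eisensteinSeries (N := 1) 0 4 UpperHalfPlane.I := rfl
  rw [hE]
  have h2 : gaussianPeriods.G 4 =
      ∑' v : Fin 2 → ℤ, EisensteinSeries.eisSummand 4 v UpperHalfPlane.I := by
    rw [G, ← gaussianPeriods.latticeEquivProd.symm.toEquiv.tsum_eq, ← (Equiv.prodComm ℤ ℤ).tsum_eq,
      ← (finTwoArrowEquiv ℤ).tsum_eq]
    congr 1 with v
    have h3 : ((gaussianPeriods.latticeEquivProd.symm.toEquiv (v 1, v 0)).1 : ℂ) =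
        v 1 + v 0 * Complex.I := by
      refine (gaussianPeriods.latticeEquiv_symm_apply (v 1, v 0)).trans ?_
      simp [gaussianPeriods]
    have h4 : (finTwoArrowEquiv ℤ v).swap = (v 1, v 0) := rfl
    rw [Equiv.prodComm_apply, h4, h3, EisensteinSeries.eisSummand, add_comm, zpow_neg]
    norm_cast
  rw [h2]
  have h5 := riemannZeta_four
  push_cast at h h5 ⊢
  rw [h, h5]
  ring

lemma E₄_I_eq_ofReal : ∃ r : ℝ, 0 < r ∧ ModularForm.E₄ UpperHalfPlane.I = r := by
  have h := EisensteinSeries.q_expansion_bernoulli (k := 4) (by norm_num) (by decide)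
    UpperHalfPlane.I
  have hq : Complex.exp (2 * π * Complex.I * (UpperHalfPlane.I : UpperHalfPlane)) =
      (rexp (-(2 * π)) : ℝ) := by
    push_cast
    congr 1
    linear_combination 2 * π * Complex.I_sq
  rw [hq, show bernoulli 4 = -1 / 30 by decide +kernel] at h
  refine ⟨1 + 240 * ∑' n : ℕ+, (ArithmeticFunction.sigma 3 n : ℝ) * rexp (-(2 * π)) ^ (n : ℤ),
    by positivity, ?_⟩
  rw [h]
  push_cast
  norm_num

open Filter Topology in
lemma tendsto_weierstrassP_re_atTop :
    Tendsto (fun x : ℝ => (gaussianPeriods.weierstrassP x).re) (𝓝[>] 0) atTop := by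
  have h1 : ∀ x : ℝ, (gaussianPeriods.weierstrassP x).re =
      (gaussianPeriods.weierstrassPExcept 0 x).re + (x ^ 2)⁻¹ := by
    intro x
    have := gaussianPeriods.weierstrassPExcept_add 0 x
    rw [← this]
    simp only [ZeroMemClass.coe_zero, sub_zero, Complex.add_re, add_right_inj]
    have h0 : (1 / (x : ℂ) ^ 2 - 1 / 0 ^ 2) = (((x ^ 2)⁻¹ : ℝ) : ℂ) := by push_cast; simp
    rw [h0, Complex.ofReal_re]
  simp_rw [h1]
  have hc : ContinuousAt (gaussianPeriods.weierstrassPExcept 0) 0 := by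
    simpa using (gaussianPeriods.analyticAt_weierstrassPExcept 0).continuousAt
  have h2 : Tendsto (fun x : ℝ => (gaussianPeriods.weierstrassPExcept 0 x).re) (𝓝[>] 0)
      (𝓝 (gaussianPeriods.weierstrassPExcept 0 0).re) := by
    have h3 : Tendsto (fun x : ℝ => (x : ℂ)) (𝓝[>] 0) (𝓝 0) := by
      simpa using (Complex.continuous_ofReal.tendsto 0).mono_left nhdsWithin_le_nhds
    exact (Complex.continuous_re.tendsto _).comp (hc.tendsto.comp h3)
  refine h2.add_atTop (Filter.Tendsto.inv_tendsto_nhdsGT_zero ?_)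
  refine tendsto_nhdsWithin_iff.2 ⟨?_, ?_⟩
  · have : Tendsto (fun x : ℝ => x ^ 2) (𝓝 0) (𝓝 (0 ^ 2)) := (continuous_pow 2).tendsto 0
    simpa using this.mono_left nhdsWithin_le_nhds
  · filter_upwards [self_mem_nhdsWithin] with x hx
    exact pow_pos (Set.mem_Ioi.1 hx) 2

lemma ofReal_notMem_lattice {x : ℝ} (hx : x ∈ Set.Ioo (0 : ℝ) 1) :
    (x : ℂ) ∉ gaussianPeriods.lattice := by
  rintro h
  obtain ⟨m, n, h⟩ := mem_lattice_iff.1 h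
  have h2 : (m : ℝ) = x := by simpa using congrArg Complex.re h
  rw [← h2] at hx
  have h3 : 0 < m := by exact_mod_cast hx.1
  have h4 : m < 1 := by exact_mod_cast hx.2
  lia

lemma deriv_weierstrassP_re {x : ℝ} (hx : x ∈ Set.Ioo (0 : ℝ) 1) :
    HasDerivAt (fun x : ℝ => (gaussianPeriods.weierstrassP x).re)
      (gaussianPeriods.derivWeierstrassP x).re x := by
  have h := (gaussianPeriods.analyticOnNhd_weierstrassP x
    (ofReal_notMem_lattice hx)).differentiableAt.hasDerivAt
  rw [deriv_weierstrassP] at h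
  exact h.real_of_complex

lemma derivWeierstrassP_ofReal {x : ℝ} (hx : x ∈ Set.Ioo (0 : ℝ) 1) :
    gaussianPeriods.derivWeierstrassP x = ((gaussianPeriods.derivWeierstrassP x).re : ℝ) := by
  have h := (gaussianPeriods.analyticOnNhd_weierstrassP x
    (ofReal_notMem_lattice hx)).differentiableAt.hasDerivAt
  rw [deriv_weierstrassP] at h
  have h1 := h.comp_ofReal
  have h2 := (deriv_weierstrassP_re hx).ofReal_comp
  simp_rw [← weierstrassP_ofReal] at h2
  exact h1.unique h2

lemma derivWeierstrassP_half : gaussianPeriods.derivWeierstrassP (1 / 2 : ℝ) = 0 := by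
  have h := gaussianPeriods.derivWeierstrassP_add_coe (-(1 / 2))
    ⟨1, mem_lattice_iff.2 ⟨1, 0, by simp⟩⟩
  rw [derivWeierstrassP_neg, show -(1 / 2 : ℂ) + 1 = 1 / 2 by norm_num] at h
  push_cast
  exact CharZero.eq_neg_self_iff.1 h

end gaussianPeriods

open gaussianPeriods in
theorem E₄_I : ModularForm.E₄ UpperHalfPlane.I =
    ((3 * Real.Gamma (1 / 4) ^ 8 / (64 * π ^ 6) : ℝ) : ℂ) := by
  obtain ⟨r, hr, hE⟩ := E₄_I_eq_ofReal
  set a : ℝ := √(π ^ 4 * r / 3) with ha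
  have ha0 : 0 < a := Real.sqrt_pos.2 (by positivity)
  have ha2 : a ^ 2 = π ^ 4 * r / 3 := Real.sq_sqrt (by positivity)
  have hg2 : gaussianPeriods.g₂ = ((4 * a ^ 2 : ℝ) : ℂ) := by
    rw [PeriodPair.g₂, G_four, hE, ha2]
    push_cast
    ring
  have hg3 : gaussianPeriods.g₃ = 0 := by rw [PeriodPair.g₃, G_six, mul_zero]
  have hbeta := betaIntegral_eq_of_half_period
    (f := fun x : ℝ => (gaussianPeriods.weierstrassP x).re) ha0
    (fun x hx => (gaussianPeriods.analyticOnNhd_weierstrassP x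
      (ofReal_notMem_lattice hx)).re_ofReal)
    (fun x hx => by
      rw [(deriv_weierstrassP_re hx).deriv]
      have h := gaussianPeriods.derivWeierstrassP_sq x (ofReal_notMem_lattice hx)
      rw [derivWeierstrassP_ofReal hx, weierstrassP_ofReal, hg2, hg3] at h
      have h' : ((gaussianPeriods.derivWeierstrassP x).re : ℝ) ^ 2 =
        4 * (gaussianPeriods.weierstrassP x).re ^ 3 -
          4 * a ^ 2 * (gaussianPeriods.weierstrassP x).re - 0 := by exact_mod_cast h
      rw [h', sub_zero])
    tendsto_weierstrassP_re_atTop (by simp)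
    (by rw [(deriv_weierstrassP_re (by norm_num)).deriv, derivWeierstrassP_half, Complex.zero_re])
  have hΓ := Complex.Gamma_mul_Gamma_eq_betaIntegral (s := 1 / 4) (t := 1 / 2) (by simp) (by simp)
  have hrefl := Real.Gamma_mul_Gamma_one_sub (1 / 4)
  have hhalf := Real.Gamma_one_half_eq
  rw [hbeta, show (1 / 4 + 1 / 2 : ℂ) = ((3 / 4 : ℝ) : ℂ) by push_cast; norm_num,
    show (1 / 4 : ℂ) = ((1 / 4 : ℝ) : ℂ) by push_cast; rfl,
    show (1 / 2 : ℂ) = ((1 / 2 : ℝ) : ℂ) by push_cast; rfl] at hΓ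
  simp only [Complex.Gamma_ofReal] at hΓ
  have hΓ' : Real.Gamma (1 / 4) * Real.Gamma (1 / 2) = Real.Gamma (3 / 4) * (2 * √a) := by
    exact_mod_cast hΓ
  rw [hhalf] at hΓ'
  rw [show (1 - 1 / 4 : ℝ) = 3 / 4 by norm_num, show π * (1 / 4) = π / 4 by ring,
    Real.sin_pi_div_four] at hrefl
  have hG := Real.Gamma_pos_of_pos (show (0 : ℝ) < 1 / 4 by norm_num)
  have hG' := Real.Gamma_pos_of_pos (show (0 : ℝ) < 3 / 4 by norm_num)
  set G := Real.Gamma (1 / 4)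
  set G' := Real.Gamma (3 / 4)
  have hGG : G ^ 2 * G' ^ 2 = 2 * π ^ 2 := by
    rw [← mul_pow, hrefl, div_pow, div_pow, Real.sq_sqrt (by norm_num)]
    ring
  have hGa : G ^ 2 * π = G' ^ 2 * (4 * a) := by
    have := congrArg (· ^ 2) hΓ'
    simp only [mul_pow, Real.sq_sqrt pi_pos.le, Real.sq_sqrt ha0.le] at this
    linarith
  have hπ := pi_pos
  have haG : a = G ^ 4 / (8 * π) := by
    rw [eq_div_iff (by positivity)]
    have : G' ^ 2 * π * (a * (8 * π)) = G' ^ 2 * π * G ^ 4 := by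
      linear_combination -2 * π ^ 2 * hGa - π * G ^ 2 * hGG
    exact mul_left_cancel₀ (by positivity) this
  rw [hE]
  congr 1
  have hr' : r = 3 * a ^ 2 / π ^ 4 := by rw [ha2]; field_simp
  rw [hr', haG]
  field_simp
  ring

section LambertSeries

open ArithmeticFunction
open scoped ArithmeticFunction.sigma

lemma summable_pnat_pow_mul_geometric (a : ℕ) {s : ℝ} (hs0 : 0 ≤ s) (hs : s < 1) :
    Summable fun n : ℕ+ ↦ (n : ℝ) ^ a * s ^ (n : ℕ) := by
  have h : Summable fun n : ℕ ↦ (n : ℝ) ^ a * s ^ n :=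
    summable_pow_mul_geometric_of_norm_lt_one a (by rwa [Real.norm_of_nonneg hs0])
  exact h.comp_injective PNat.coe_injective

lemma summable_pow_mul_pow_mul_pow_mul (a b : ℕ) {r : ℂ} (hr : ‖r‖ < 1) :
    Summable fun c : ℕ+ × ℕ+ ↦ (c.1 : ℂ) ^ a * (c.2 : ℂ) ^ b * r ^ (c.1 * c.2 : ℕ) := by
  obtain ⟨s, hrs, hs⟩ := exists_between hr
  have hs0 : 0 < s := (norm_nonneg r).trans_lt hrs
  have hprod := ((summable_pnat_pow_mul_geometric a hs0.le hs).mul_of_nonneg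
    (summable_pnat_pow_mul_geometric b hs0.le hs) (fun _ ↦ by positivity)
    (fun _ ↦ by positivity)).mul_left s⁻¹
  refine .of_norm_bounded hprod fun ⟨n, m⟩ ↦ ?_
  have hexp : (n : ℕ) + m - 1 ≤ n * m := by
    obtain ⟨x, hx⟩ := Nat.exists_eq_add_of_le n.2
    obtain ⟨y, hy⟩ := Nat.exists_eq_add_of_le m.2
    simp only [PNat.val] at *
    rw [hx, hy]
    ring_nf
    omega
  have hpow : ‖r‖ ^ (n * m : ℕ) ≤ s⁻¹ * (s ^ (n : ℕ) * s ^ (m : ℕ)) := by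
    calc ‖r‖ ^ (n * m : ℕ) ≤ s ^ (n * m : ℕ) := by gcongr
      _ ≤ s ^ ((n : ℕ) + m - 1) := pow_le_pow_of_le_one hs0.le hs.le hexp
      _ = s⁻¹ * (s ^ (n : ℕ) * s ^ (m : ℕ)) := by
        rw [← pow_add, pow_sub₀ _ hs0.ne' (by have := n.pos; omega), pow_one, mul_comm]
  simp only [norm_mul, norm_pow, Complex.norm_natCast]
  calc (n : ℝ) ^ a * (m : ℝ) ^ b * ‖r‖ ^ (n * m : ℕ)
      ≤ (n : ℝ) ^ a * (m : ℝ) ^ b * (s⁻¹ * (s ^ (n : ℕ) * s ^ (m : ℕ))) := by gcongr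
    _ = _ := by ring

lemma tsum_pow_mul_pow_mul_pow_mul (b k : ℕ) {r : ℂ} (hr : ‖r‖ < 1) :
    ∑' c : ℕ+ × ℕ+, (c.1 : ℂ) ^ (b + k) * (c.2 : ℂ) ^ b * r ^ (c.1 * c.2 : ℕ) =
      ∑' n : ℕ+, (n : ℂ) ^ b * σ k n * r ^ (n : ℕ) := by
  have hS := sigmaAntidiagonalEquivProd.summable_iff.mpr
    (summable_pow_mul_pow_mul_pow_mul (b + k) b hr)
  rw [← sigmaAntidiagonalEquivProd.tsum_eq]
  refine hS.tsum_sigma.trans (tsum_congr fun n ↦ ?_)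
  rw [tsum_fintype, Finset.univ_eq_attach]
  refine ((n : ℕ).divisorsAntidiagonal.sum_attach fun x : ℕ × ℕ ↦
    (x.1 : ℂ) ^ (b + k) * (x.2 : ℂ) ^ b * r ^ (x.1 * x.2)).trans ?_
  rw [Nat.sum_divisorsAntidiagonal fun x y : ℕ ↦ (x : ℂ) ^ (b + k) * (y : ℂ) ^ b * r ^ (x * y),
    sigma_apply, Nat.cast_sum, Finset.mul_sum, Finset.sum_mul]
  refine Finset.sum_congr rfl fun d hd ↦ ?_
  have hmul : d * ((n : ℕ) / d) = n := Nat.mul_div_cancel' (Nat.dvd_of_mem_divisors hd)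
  have hmulC : (d : ℂ) * (((n : ℕ) / d : ℕ) : ℂ) = (n : ℕ) := by exact_mod_cast hmul
  rw [hmul, ← hmulC, pow_add, mul_pow]
  push_cast
  ring

/-- The polylogarithm-type series `∑_{m ≥ 1} m ^ b w ^ m`. -/
noncomputable def powerSum (b : ℕ) (w : ℂ) : ℂ := ∑' m : ℕ+, (m : ℂ) ^ b * w ^ (m : ℕ)

lemma hasSum_pow_mul_powerSum (b k : ℕ) (τ : UpperHalfPlane) :
    HasSum (fun n : ℕ+ ↦ (n : ℂ) ^ (b + k) *
      powerSum b (Complex.exp (2 * π * Complex.I * τ) ^ (n : ℕ))) (divisorSeries b k τ) := by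
  have hr := UpperHalfPlane.norm_exp_two_pi_I_lt_one τ
  have hS := summable_pow_mul_pow_mul_pow_mul (b + k) b hr
  have h := hS.hasSum.prod_fiberwise fun n ↦ (hS.prod_factor n).hasSum
  rw [tsum_pow_mul_pow_mul_pow_mul b k hr] at h
  convert! h using 1
  · ext n
    rw [powerSum, ← tsum_mul_left]
    refine tsum_congr fun m ↦ ?_
    rw [← pow_mul]
    ring
  · rw [divisorSeries, ← tsum_zero_pnat_eq_tsum_nat (divisorSeries.summable_term b k hr)]
    simp

lemma powerSum_eq_tsum_nat (b : ℕ) {w : ℂ} (hw : ‖w‖ < 1) :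
    (0 : ℂ) ^ b + powerSum b w = ∑' m : ℕ, (m : ℂ) ^ b * w ^ m := by
  have h : Summable fun m : ℕ ↦ (m : ℂ) ^ b * w ^ m :=
    summable_pow_mul_geometric_of_norm_lt_one b hw
  rw [← tsum_zero_pnat_eq_tsum_nat h]
  simp [powerSum]

lemma cast_choose_four (j : ℕ) : (24 : ℂ) * ((j + 4).choose 4 : ℕ) =
    (j + 1) * (j + 2) * (j + 3) * (j + 4) := by
  have h := Nat.descFactorial_eq_factorial_mul_choose (j + 4) 4
  have h2 : (j + 4).descFactorial 4 = (j + 1) * (j + 2) * (j + 3) * (j + 4) := by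
    simp [Nat.descFactorial]
    ring
  have h3 : 24 * (j + 4).choose 4 = (j + 1) * (j + 2) * (j + 3) * (j + 4) := by
    rw [← h2, h]; rfl
  exact_mod_cast h3

lemma hasSum_odd {w : ℂ} (hw : ‖w‖ < 1) :
    HasSum (fun k : ℕ ↦ (((2 * k + 1 : ℕ) : ℂ) ^ 4 - 10 * ((2 * k + 1 : ℕ) : ℂ) ^ 2 + 9) *
      w ^ (2 * k + 1)) (384 * w ^ 5 / (1 - w ^ 2) ^ 5) := by
  have hw2 : ‖w ^ 2‖ < 1 := by
    rw [norm_pow]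
    exact pow_lt_one₀ (norm_nonneg _) hw two_ne_zero
  rw [← hasSum_nat_add_iff' 2]
  convert! (hasSum_choose_mul_geometric_of_norm_lt_one 4 hw2).mul_left (384 * w ^ 5) using 1
  · ext j
    have h := cast_choose_four j
    push_cast
    linear_combination (-16 * w ^ (2 * (j + 2) + 1)) * h
  · simp [Finset.sum_range_succ]
    ring

/-- The contribution of the odd `m` to `∑ (m ^ 4 - 10 m ^ 2 + 9) w ^ m`. -/
lemma powerSum_sub_powerSum_sq {w : ℂ} (hw : ‖w‖ < 1) :
    (powerSum 4 w - 10 * powerSum 2 w + 9 * powerSum 0 w) -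
      (16 * powerSum 4 (w ^ 2) - 40 * powerSum 2 (w ^ 2) + 9 * powerSum 0 (w ^ 2)) =
      384 * w ^ 5 / (1 - w ^ 2) ^ 5 := by
  have hw2 : ‖w ^ 2‖ < 1 := by
    rw [norm_pow]
    exact pow_lt_one₀ (norm_nonneg _) hw two_ne_zero
  have hs (b : ℕ) {z : ℂ} (hz : ‖z‖ < 1) : HasSum (fun m : ℕ ↦ (m : ℂ) ^ b * z ^ m)
      ((0 : ℂ) ^ b + powerSum b z) := by
    rw [powerSum_eq_tsum_nat b hz]
    exact (summable_pow_mul_geometric_of_norm_lt_one b hz).hasSum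
  have hall : HasSum (fun m : ℕ ↦ ((m : ℂ) ^ 4 - 10 * (m : ℂ) ^ 2 + 9) * w ^ m)
      (powerSum 4 w - 10 * powerSum 2 w + 9 * powerSum 0 w + 9) := by
    convert! ((hs 4 hw).sub ((hs 2 hw).mul_left 10)).add ((hs 0 hw).mul_left 9) using 1
    · ext m; ring
    · norm_num; ring
  have heven : HasSum (fun m : ℕ ↦ (((2 * m : ℕ) : ℂ) ^ 4 - 10 * ((2 * m : ℕ) : ℂ) ^ 2 + 9) *
      w ^ (2 * m))
      (16 * powerSum 4 (w ^ 2) - 40 * powerSum 2 (w ^ 2) + 9 * powerSum 0 (w ^ 2) + 9) := by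
    convert! (((hs 4 hw2).mul_left 16).sub ((hs 2 hw2).mul_left 40)).add
      ((hs 0 hw2).mul_left 9) using 1
    · ext m
      rw [← pow_mul]
      push_cast
      ring
    · norm_num; ring
  linear_combination hall.unique (heven.even_add_odd (hasSum_odd hw))

end LambertSeries

section SinhSeries

open UpperHalfPlane hiding I
open Complex (I)

/-- The nome at `τ = (1 + i) / 2` is `-exp (-π)`. -/
lemma cexp_two_pi_I_mul_half_one_add_I :
    Complex.exp (2 * π * I * ((1 + I) / 2)) = -((Real.exp (-π) : ℝ) : ℂ) := by
  rw [show 2 * (π : ℂ) * I * ((1 + I) / 2) = π * I + ((-π : ℝ) : ℂ) by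
    push_cast; linear_combination (π : ℂ) * Complex.I_sq]
  rw [Complex.exp_add, Complex.exp_pi_mul_I, Complex.ofReal_exp]
  ring

lemma pow_div_one_sub_sq_pow_eq_sinh (n : ℕ) (hn : n ≠ 0) :
    384 * ((-((Real.exp (-π) : ℝ) : ℂ)) ^ n) ^ 5 /
        (1 - ((-((Real.exp (-π) : ℝ) : ℂ)) ^ n) ^ 2) ^ 5 =
      12 * (((-1 : ℝ) ^ n / Real.sinh (n * π) ^ 5 : ℝ) : ℂ) := by
  have hpos : 0 < (n : ℝ) * π := by positivity
  have hsinh : Real.sinh (n * π) ≠ 0 := (Real.sinh_pos_iff.mpr hpos).ne'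
  set y := Real.exp (-π) ^ n with hy
  have hy0 : y ≠ 0 := by positivity
  have hexp : Real.exp (-(n * π)) = y := by
    rw [hy, ← Real.exp_nat_mul]
    ring_nf
  have hdef : 2 * y * Real.sinh (n * π) = 1 - y ^ 2 := by
    have h1 : Real.exp (n * π) * y = 1 := by rw [← hexp, ← Real.exp_add]; simp
    rw [Real.sinh_eq, hexp]
    linear_combination h1
  have hsign : ((-1 : ℝ) ^ n) ^ 2 = 1 := by rw [← pow_mul, mul_comm, pow_mul]; simp
  have hneg : (-Real.exp (-π)) ^ n = (-1) ^ n * y := by rw [neg_pow]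
  have key : 384 * ((-Real.exp (-π)) ^ n) ^ 5 / (1 - ((-Real.exp (-π)) ^ n) ^ 2) ^ 5 =
      12 * ((-1) ^ n / Real.sinh (n * π) ^ 5) := by
    have hsign5 : ((-1 : ℝ) ^ n) ^ 5 = (-1) ^ n := by
      linear_combination ((-1 : ℝ) ^ n * (((-1 : ℝ) ^ n) ^ 2 + 1)) * hsign
    rw [hneg, mul_pow, mul_pow, hsign, one_mul, ← hdef, hsign5]
    field_simp
    norm_num
  exact_mod_cast congrArg ((↑) : ℝ → ℂ) key

lemma hasSum_sinh {τ₁ τ₂ : ℍ} (h₁ : (τ₁ : ℂ) = (1 + I) / 2) (h₂ : (τ₂ : ℂ) = 1 + I) :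
    HasSum (fun n : ℕ+ ↦
      12 * (((-1 : ℝ) ^ (n : ℕ) * (n : ℝ) ^ 7 / Real.sinh (n * π) ^ 5 : ℝ) : ℂ))
      ((divisorSeries 4 3 τ₁ - 10 * divisorSeries 2 5 τ₁ + 9 * divisorSeries 0 7 τ₁) -
        (16 * divisorSeries 4 3 τ₂ - 40 * divisorSeries 2 5 τ₂ + 9 * divisorSeries 0 7 τ₂)) := by
  have hq : Complex.exp (2 * π * I * τ₂) = Complex.exp (2 * π * I * τ₁) ^ 2 := by
    rw [← Complex.exp_nat_mul, h₁, h₂]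
    congr 1
    push_cast
    ring
  have h (b k : ℕ) (τ : ℍ) := hasSum_pow_mul_powerSum b k τ
  convert! (((h 4 3 τ₁).sub ((h 2 5 τ₁).mul_left 10)).add ((h 0 7 τ₁).mul_left 9)).sub
    ((((h 4 3 τ₂).mul_left 16).sub ((h 2 5 τ₂).mul_left 40)).add ((h 0 7 τ₂).mul_left 9)) using 1
  ext n
  have hw : ‖Complex.exp (2 * π * I * τ₁) ^ (n : ℕ)‖ < 1 := by
    rw [norm_pow]
    exact pow_lt_one₀ (norm_nonneg _) (norm_exp_two_pi_I_lt_one τ₁) n.ne_zero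
  have hP := powerSum_sub_powerSum_sq hw
  rw [hq, pow_right_comm]
  rw [h₁, cexp_two_pi_I_mul_half_one_add_I] at hP ⊢
  rw [pow_div_one_sub_sq_pow_eq_sinh n n.ne_zero] at hP
  push_cast at hP ⊢
  linear_combination (-(n : ℂ) ^ 7) * hP

end SinhSeries

theorem sum_n7_sinh_fifth :
    (∑' n : ℕ, (-1 : ℝ) ^ (n+1) * ((n:ℝ)+1) ^ 7 / Real.sinh (((n:ℝ)+1) * π) ^ 5) =
      -(35 * Real.Gamma (1/4) ^ 8 / (2 ^ 13 * π ^ 10))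
    + 21 * Real.Gamma (1/4) ^ 16 / (2 ^ 18 * π ^ 14)
    - 35 * Real.Gamma (1/4) ^ 16 / (3 * 2 ^ 16 * π ^ 13)
    + 27 * Real.Gamma (1/4) ^ 16 / (2 ^ 19 * π ^ 12)
    - 5 * Real.Gamma (1/4) ^ 24 / (3 * 2 ^ 25 * π ^ 18) := by
  obtain ⟨τ₁, h₁⟩ : ∃ τ : UpperHalfPlane, (τ : ℂ) = (1 + Complex.I) / 2 :=
    ⟨⟨(1 + Complex.I) / 2, by simp⟩, rfl⟩
  obtain ⟨τ₂, h₂⟩ : ∃ τ : UpperHalfPlane, (τ : ℂ) = 1 + Complex.I :=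
    ⟨⟨1 + Complex.I, by simp⟩, rfl⟩
  have hsum := (hasSum_sinh h₁ h₂).tsum_eq
  rw [tsum_mul_left, ← Complex.ofReal_tsum, tsum_pnat_eq_tsum_succ
    (f := fun n : ℕ ↦ (-1 : ℝ) ^ n * (n : ℝ) ^ 7 / Real.sinh (n * π) ^ 5)] at hsum
  simp only [divisorSeries_zero_seven, divisorSeries_two_five (E₆_half_one_add_I h₁),
    divisorSeries_two_five (E₆_one_add_I h₂), divisorSeries_four_three (E₆_half_one_add_I h₁),
    divisorSeries_four_three (E₆_one_add_I h₂), E₂_half_one_add_I h₁, E₂_one_add_I h₂,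
    E₄_half_one_add_I h₁, E₄_one_add_I h₂, E₄_I, Nat.cast_add, Nat.cast_one] at hsum
  apply Complex.ofReal_injective
  rw [← mul_right_inj' (show (12 : ℂ) ≠ 0 by norm_num), hsum]
  have hπ : (π : ℂ) ≠ 0 := by exact_mod_cast Real.pi_ne_zero
  push_cast
  field_simp
  ring
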